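/- Let G be a connected graph which is regular of degree d ≥ 2, with simple random walk spectral radius ρ(G). Then its Cheeger constant satisfies I_∞(G) ≥ 4·(1 − ρ(G))/ρ(G). -/

import Mathlib

open Finset
open scoped Classical

noncomputable section

/-- The spectral radius `ρ(G) = sup {⟨h, Th⟩ : ‖h‖_{ℓ²(𝒢,deg)} ≤ 1}` of the simple random walk
on a locally finite graph `G`, expressed via finitely supported functions:
`⟨h, Th⟩ = Σ_x Σ_{y ∼ x} h(x) h(y)` and `‖h‖² = Σ_x deg(x) h(x)²`. -/
def SimpleGraph.srwSpectralRadius {V : Type*} (G : SimpleGraph V) [G.LocallyFinite] : ℝ :=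
  sSup {r | ∃ (s : Finset V) (f : V → ℝ), (∀ x ∉ s, f x = 0) ∧
    (∑ x ∈ s, (G.degree x : ℝ) * f x ^ 2) ≤ 1 ∧
    r = ∑ x ∈ s, ∑ y ∈ s, if G.Adj x y then f x * f y else 0}

/-- The Cheeger constant `I_∞(G) = inf {|∂F|/|F| : F finite nonempty}` of a graph, where
`∂F` is the set of vertices outside `F` adjacent to a vertex of `F`. -/
def SimpleGraph.cheegerConst {V : Type*} (G : SimpleGraph V) : ℝ :=
  sInf {r | ∃ F : Finset V, F.Nonempty ∧
    r = (Set.ncard {y | y ∉ F ∧ ∃ x ∈ F, G.Adj x y} : ℝ) / F.card}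

namespace SimpleGraph

variable {V : Type*} (G : SimpleGraph V) [G.LocallyFinite]

lemma sum_ite_adj_one_le_degree (s : Finset V) (x : V) :
    (∑ y ∈ s, if G.Adj x y then (1 : ℝ) else 0) ≤ G.degree x := by
  rw [Finset.sum_boole, ← G.card_neighborFinset_eq_degree x]
  refine Nat.cast_le.mpr (Finset.card_le_card fun y hy => ?_)
  simpa using (Finset.mem_filter.mp hy).2

lemma sum_ite_adj_one_eq_degree {s : Finset V} {x : V} (h : ∀ y, G.Adj x y → y ∈ s) :
    (∑ y ∈ s, if G.Adj x y then (1 : ℝ) else 0) = G.degree x := by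
  rw [Finset.sum_boole, ← G.card_neighborFinset_eq_degree x]
  congr 2
  ext y
  simpa using h y

lemma sum_adj_mul_le_sum_degree_mul_sq (s : Finset V) (f : V → ℝ) :
    (∑ x ∈ s, ∑ y ∈ s, if G.Adj x y then f x * f y else 0) ≤
      ∑ x ∈ s, (G.degree x : ℝ) * f x ^ 2 := by
  have hrow : (∑ x ∈ s, ∑ y ∈ s, if G.Adj x y then f x ^ 2 else 0) ≤
      ∑ x ∈ s, (G.degree x : ℝ) * f x ^ 2 := by
    refine Finset.sum_le_sum fun x _ => ?_
    calc (∑ y ∈ s, if G.Adj x y then f x ^ 2 else 0)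
        = (∑ y ∈ s, if G.Adj x y then (1 : ℝ) else 0) * f x ^ 2 := by
          simp only [Finset.sum_mul, ite_mul, one_mul, zero_mul]
      _ ≤ _ := mul_le_mul_of_nonneg_right (G.sum_ite_adj_one_le_degree s x) (sq_nonneg _)
  have hcol : (∑ x ∈ s, ∑ y ∈ s, if G.Adj x y then f y ^ 2 else 0) =
      ∑ x ∈ s, ∑ y ∈ s, if G.Adj x y then f x ^ 2 else 0 := by
    rw [Finset.sum_comm]
    simp only [G.adj_comm]
  have hle : 2 * (∑ x ∈ s, ∑ y ∈ s, if G.Adj x y then f x * f y else 0) ≤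
      (∑ x ∈ s, ∑ y ∈ s, if G.Adj x y then f x ^ 2 else 0) +
        ∑ x ∈ s, ∑ y ∈ s, if G.Adj x y then f y ^ 2 else 0 := by
    simp only [Finset.mul_sum, ← Finset.sum_add_distrib]
    refine Finset.sum_le_sum fun x _ => Finset.sum_le_sum fun y _ => ?_
    split_ifs
    · nlinarith [sq_nonneg (f x - f y)]
    · simp
  linarith

lemma sum_adj_mul_le_srwSpectralRadius_mul {s : Finset V} {f : V → ℝ}
    (hf : ∀ x ∉ s, f x = 0) (hpos : 0 < ∑ x ∈ s, (G.degree x : ℝ) * f x ^ 2) :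
    (∑ x ∈ s, ∑ y ∈ s, if G.Adj x y then f x * f y else 0) ≤
      G.srwSpectralRadius * ∑ x ∈ s, (G.degree x : ℝ) * f x ^ 2 := by
  set N := ∑ x ∈ s, (G.degree x : ℝ) * f x ^ 2 with hN
  have hsq : (√N)⁻¹ ^ 2 = N⁻¹ := by rw [inv_pow, Real.sq_sqrt hpos.le]
  rw [← div_le_iff₀ hpos]
  refine le_csSup ⟨1, ?_⟩ ⟨s, fun x => (√N)⁻¹ * f x, fun x hx => by simp [hf x hx], ?_, ?_⟩
  · rintro r ⟨t, g, -, hg, rfl⟩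
    exact (G.sum_adj_mul_le_sum_degree_mul_sq t g).trans hg
  · refine le_of_eq ?_
    calc (∑ x ∈ s, (G.degree x : ℝ) * ((√N)⁻¹ * f x) ^ 2) = (√N)⁻¹ ^ 2 * N := by
          rw [hN, Finset.mul_sum]
          exact Finset.sum_congr rfl fun x _ => by ring
      _ = 1 := by rw [hsq, inv_mul_cancel₀ hpos.ne']
  · rw [div_eq_inv_mul, ← hsq]
    simp only [Finset.mul_sum]
    refine Finset.sum_congr rfl fun x _ => Finset.sum_congr rfl fun y _ => ?_
    split_ifs <;> ring

/-- The function `1` on `F`, `1 / 2` on the disjoint set `B` containing all other neighbours of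
`F`, has large energy. -/
lemma sum_degree_le_sum_adj_mul {F B : Finset V} (hdisj : Disjoint F B)
    (hB : ∀ x ∈ F, ∀ y, G.Adj x y → y ∈ F ∪ B) {f : V → ℝ}
    (hfF : ∀ x ∈ F, f x = 1) (hfB : ∀ x ∈ B, f x = 1 / 2) :
    (∑ x ∈ F, (G.degree x : ℝ)) ≤
      ∑ x ∈ F ∪ B, ∑ y ∈ F ∪ B, if G.Adj x y then f x * f y else 0 := by
  have hdeg : (∑ x ∈ F, (G.degree x : ℝ)) =
      (∑ x ∈ F, ∑ y ∈ F, if G.Adj x y then (1 : ℝ) else 0) +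
        ∑ x ∈ F, ∑ y ∈ B, if G.Adj x y then (1 : ℝ) else 0 := by
    rw [← Finset.sum_add_distrib]
    refine Finset.sum_congr rfl fun x hx => ?_
    rw [← G.sum_ite_adj_one_eq_degree (hB x hx), Finset.sum_union hdisj]
  have hFF : (∑ x ∈ F, ∑ y ∈ F, if G.Adj x y then f x * f y else 0) =
      ∑ x ∈ F, ∑ y ∈ F, if G.Adj x y then (1 : ℝ) else 0 :=
    Finset.sum_congr rfl fun x hx => Finset.sum_congr rfl fun y hy => by
      simp [hfF x hx, hfF y hy]
  have hFB : (∑ x ∈ F, ∑ y ∈ B, if G.Adj x y then f x * f y else 0) =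
      1 / 2 * ∑ x ∈ F, ∑ y ∈ B, if G.Adj x y then (1 : ℝ) else 0 := by
    simp only [Finset.mul_sum]
    exact Finset.sum_congr rfl fun x hx => Finset.sum_congr rfl fun y hy => by
      simp [hfF x hx, hfB y hy]
  have hBF : (∑ x ∈ B, ∑ y ∈ F, if G.Adj x y then f x * f y else 0) =
      ∑ x ∈ F, ∑ y ∈ B, if G.Adj x y then f x * f y else 0 := by
    rw [Finset.sum_comm]
    simp only [G.adj_comm, mul_comm]
  have hBB : 0 ≤ ∑ x ∈ B, ∑ y ∈ B, if G.Adj x y then f x * f y else 0 :=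
    Finset.sum_nonneg fun x hx => Finset.sum_nonneg fun y hy => by
      rw [hfB x hx, hfB y hy]
      split_ifs <;> norm_num
  rw [Finset.sum_union hdisj]
  simp only [Finset.sum_union hdisj, Finset.sum_add_distrib]
  linarith

end SimpleGraph

/-- For a connected graph which is regular of degree `d ≥ 2`, the Cheeger
constant satisfies `I_∞(G) ≥ 4 (1 - ρ(G)) / ρ(G)`, where `ρ(G)` is the spectral radius of the
simple random walk. -/
theorem cheeger_ge_of_spectralRadius {V : Type*} (G : SimpleGraph V) [G.LocallyFinite]
    (hconn : G.Connected) (d : ℕ) (hd : 2 ≤ d) (hreg : G.IsRegularOfDegree d) :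
    4 * (1 - G.srwSpectralRadius) / G.srwSpectralRadius ≤ G.cheegerConst := by
  have key : ∀ F : Finset V, F.Nonempty → (F.card : ℝ) ≤ G.srwSpectralRadius *
      (F.card + (Set.ncard {y | y ∉ F ∧ ∃ x ∈ F, G.Adj x y} : ℝ) / 4) := by
    intro F hF
    set B : Finset V := (F.biUnion fun x => G.neighborFinset x) \ F with hBdef
    have hset : {y | y ∉ F ∧ ∃ x ∈ F, G.Adj x y} = (B : Set V) := by
      ext y
      simp [hBdef, and_comm]
    rw [hset, Set.ncard_coe_finset]
    have hdisj : Disjoint F B := Finset.disjoint_sdiff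
    have hB : ∀ x ∈ F, ∀ y, G.Adj x y → y ∈ F ∪ B := by
      intro x hx y hxy
      by_cases hy : y ∈ F
      · exact Finset.mem_union_left _ hy
      · refine Finset.mem_union_right _ (Finset.mem_sdiff.mpr ⟨?_, hy⟩)
        exact Finset.mem_biUnion.mpr ⟨x, hx, by simpa using hxy⟩
    let f : V → ℝ := fun x => if x ∈ F then 1 else if x ∈ B then 1 / 2 else 0
    have hfF : ∀ x ∈ F, f x = 1 := fun x hx => if_pos hx
    have hfB : ∀ x ∈ B, f x = 1 / 2 := fun x hx => by
      simp only [f, if_neg (Finset.disjoint_right.mp hdisj hx), if_pos hx]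
    have hf0 : ∀ x ∉ F ∪ B, f x = 0 := fun x hx => by
      rw [Finset.notMem_union] at hx
      simp only [f, if_neg hx.1, if_neg hx.2]
    have hnorm : (∑ x ∈ F ∪ B, (G.degree x : ℝ) * f x ^ 2) =
        d * (F.card + (B.card : ℝ) / 4) := by
      rw [Finset.sum_union hdisj,
        Finset.sum_congr rfl fun x hx => by rw [hfF x hx, hreg.degree_eq x],
        Finset.sum_congr (s₁ := B) rfl fun x hx => by rw [hfB x hx, hreg.degree_eq x]]
      simp only [Finset.sum_const, nsmul_eq_mul]
      ring
    have hd0 : (0 : ℝ) < d := by exact_mod_cast (by omega : 0 < d)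
    have hF0 : (0 : ℝ) < F.card := by exact_mod_cast hF.card_pos
    have henergy := (G.sum_degree_le_sum_adj_mul hdisj hB hfF hfB).trans
      (G.sum_adj_mul_le_srwSpectralRadius_mul hf0 (by rw [hnorm]; positivity))
    rw [hnorm] at henergy
    simp only [hreg.degree_eq, Finset.sum_const, nsmul_eq_mul] at henergy
    refine le_of_mul_le_mul_left ?_ hd0
    linarith
  obtain ⟨v⟩ := hconn.nonempty
  refine le_csInf ⟨_, {v}, Finset.singleton_nonempty v, rfl⟩ ?_
  rintro r ⟨F, hF, rfl⟩
  have hF0 : (0 : ℝ) < F.card := by exact_mod_cast hF.card_pos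
  have hkey := key F hF
  have hρ : 0 < G.srwSpectralRadius :=
    pos_of_mul_pos_left (hF0.trans_le hkey) (by positivity)
  rw [div_le_div_iff₀ hρ hF0]
  linarith

end
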